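/- Let M be a finite-dimensional kG-module and n a positive integer. For the constant sequence M_n = ⋯ = M_1 = M, the map ψ_{M,...,M} : ⊕_p (M^{⊗n})^G_{p,irr} → (M^{⊗n})^G, summing over all partitions p of n the multiplication maps on chosen irreducible invariant subspaces, is bijective. In other words, every invariant of M^{⊗n} decomposes uniquely as a sum of tensors of irreducible invariants. -/

import Mathlib

/-!
STATEMENT 2: For a finite-dimensional `kG`-module `M` and the constant sequence
`M_n = ⋯ = M_1 = M`, the map `ψ : ⊕_p (M^{⊗n})^G_{p,irr} → (M^{⊗n})^G` is bijective:
every invariant of `M^{⊗n}` decomposes uniquely as a sum of tensors of irreducible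
invariants.
-/

open scoped TensorProduct DirectSum Classical

section Strings

variable {k G : Type} [Field k] [Group G]
variable (M : ℕ → Type) [∀ i, AddCommGroup (M i)] [∀ i, Module k (M i)]

/-- The string `M_{i+m-1} ⊗ ⋯ ⊗ M_{i+1} ⊗ M_i` (tensor product of `m` consecutive
modules starting at `M_i`). -/
noncomputable def Str : ℕ → ℕ → ModuleCat k
  | _, 0 => ModuleCat.of k k
  | i, (m + 1) => ModuleCat.of k (↥(Str (i + 1) m) ⊗[k] M i)

/-- Transport along an equality of starting indices. -/
noncomputable def strCast {i j : ℕ} (h : i = j) (m : ℕ) :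
    ↥(Str (k := k) M i m) ≃ₗ[k] ↥(Str (k := k) M j m) :=
  h ▸ LinearEquiv.refl k ↥(Str (k := k) M i m)

/-- Transport along an equality of lengths. -/
noncomputable def strCastLen {i m m' : ℕ} (h : m = m') :
    ↥(Str (k := k) M i m) ≃ₗ[k] ↥(Str (k := k) M i m') :=
  h ▸ LinearEquiv.refl k ↥(Str (k := k) M i m)

/-- The canonical multiplication map
`(M_{i+b+a-1} ⊗ ⋯ ⊗ M_{i+b}) ⊗ (M_{i+b-1} ⊗ ⋯ ⊗ M_i) → M_{i+a+b-1} ⊗ ⋯ ⊗ M_i`. -/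
noncomputable def strMul : ∀ (a b i : ℕ),
    ↥(Str (k := k) M (i + b) a) →ₗ[k] ↥(Str (k := k) M i b) →ₗ[k] ↥(Str (k := k) M i (a + b))
  | a, 0, i => (LinearMap.lsmul k ↥(Str (k := k) M i a)).flip
  | a, b + 1, i =>
      (LinearMap.rTensorHom (M i)).comp
        ((strMul a b (i + 1)).comp
          (strCast (k := k) M (by omega : i + b + 1 = (i + 1) + b) a).toLinearMap)

variable (ρ : ∀ i, Representation k G (M i))

/-- The diagonal action of `g : G` on a string. -/
noncomputable def strAct : ∀ (i m : ℕ) (_ : G), ↥(Str (k := k) M i m) →ₗ[k] ↥(Str (k := k) M i m)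
  | _, 0, _ => LinearMap.id
  | i, m + 1, g => TensorProduct.map (strAct (i + 1) m g) (ρ i g)

/-- The invariants `(M_{i+m-1} ⊗ ⋯ ⊗ M_i)^G`. -/
noncomputable def strInv (i m : ℕ) : Submodule k ↥(Str (k := k) M i m) :=
  ⨅ g : G, LinearMap.eqLocus (strAct M ρ i m g) LinearMap.id

/-- The space of composite invariants: the span of products of invariants of the two
substrings of a proper two-fold partition. -/
noncomputable def strComp (i m : ℕ) : Submodule k ↥(Str (k := k) M i m) :=
  Submodule.span k {x | ∃ a b : ℕ, ∃ h : a + b = m, 0 < a ∧ 0 < b ∧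
    ∃ u ∈ strInv M ρ (i + b) a, ∃ w ∈ strInv M ρ i b,
      x = strCastLen M h (strMul M a b i u w)}

/-- Given a choice `Irr` of irreducible invariant subspaces, the tensor product of
the irreducible invariant spaces along a partition `l = [n_1, n_2, …]` (parts read
from the bottom). -/
noncomputable def TIrr (Irr : ∀ i m : ℕ, Submodule k ↥(Str (k := k) M i m)) :
    ℕ → List ℕ → ModuleCat k
  | _, [] => ModuleCat.of k k
  | i, (a :: l) => ModuleCat.of k (↥(TIrr Irr (i + a) l) ⊗[k] ↥(Irr i a))

/-- The multiplication map from the tensor product of irreducible invariant spaces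
along a partition into the full string. -/
noncomputable def iotaT (Irr : ∀ i m : ℕ, Submodule k ↥(Str (k := k) M i m)) :
    ∀ (i : ℕ) (l : List ℕ), ↥(TIrr (k := k) M Irr i l) →ₗ[k] ↥(Str (k := k) M i l.sum)
  | _, [] => LinearMap.id
  | i, (a :: l) =>
      TensorProduct.lift
        ((((strMul (k := k) M l.sum a i).comp (iotaT Irr (i + a) l)).compl₂
            (Irr i a).subtype).compr₂
          (strCastLen (k := k) M (by omega : l.sum + a = a + l.sum)).toLinearMap)

/-- Partitions of `n` into positive parts. -/
def Pt (n : ℕ) : Type := {l : List ℕ // l.sum = n ∧ ∀ a ∈ l, 0 < a}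

/-- The map `ψ = ⊕_p ψ_p` from the direct sum over all partitions of `n` of the
tensor products of irreducible invariant subspaces into the string of length `n`. -/
noncomputable def psiMap (Irr : ∀ i m : ℕ, Submodule k ↥(Str (k := k) M i m)) (n : ℕ) :
    (⨁ p : Pt n, ↥(TIrr (k := k) M Irr 0 p.1)) →ₗ[k] ↥(Str (k := k) M 0 n) :=
  DirectSum.toModule k _ _ fun p =>
    (strCastLen (k := k) M p.2.1).toLinearMap.comp (iotaT (k := k) M Irr 0 p.1)

end Strings

/-! ### The algebra of noncommutative polynomials and its left derivatives -/

section Words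

variable {k ι : Type} [Field k]

/-- Noncommutative polynomials of degree `m`. -/
noncomputable def wordDeg (k ι : Type) [Field k] (m : ℕ) :
    Submodule k (MonoidAlgebra k (FreeMonoid ι)) :=
  Submodule.span k {x | ∃ w : FreeMonoid ι, w.length = m ∧ x = MonoidAlgebra.single w 1}

lemma single_mem_wordDeg {m : ℕ} {w : FreeMonoid ι} (hw : w.length = m) (r : k) :
    MonoidAlgebra.single w r ∈ wordDeg k ι m := by
  have : MonoidAlgebra.single w r = r • MonoidAlgebra.single w (1 : k) := by simp
  rw [this]
  exact Submodule.smul_mem _ _ (Submodule.subset_span ⟨w, hw, rfl⟩)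

lemma wordDeg_mul (a b : ℕ) : wordDeg k ι a * wordDeg k ι b = wordDeg k ι (a + b) := by
  rw [wordDeg, wordDeg, Submodule.span_mul_span, wordDeg]
  congr 1
  ext x
  constructor
  · rintro ⟨_, ⟨u, hu, rfl⟩, _, ⟨v, hv, rfl⟩, rfl⟩
    exact ⟨u * v, by rw [FreeMonoid.length_mul, hu, hv], by simp⟩
  · rintro ⟨w, hw, rfl⟩
    refine ⟨_, ⟨FreeMonoid.ofList (w.toList.take a), ?_, rfl⟩,
      _, ⟨FreeMonoid.ofList (w.toList.drop a), ?_, rfl⟩, ?_⟩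
    · have : w.toList.length = a + b := hw
      change (w.toList.take a).length = a
      simp [this]
    · have : w.toList.length = a + b := hw
      change (w.toList.drop a).length = b
      simp [this]
    · change MonoidAlgebra.single _ 1 * MonoidAlgebra.single _ 1 = _
      rw [MonoidAlgebra.single_mul_single, ← FreeMonoid.ofList_append, List.take_append_drop]
      simp

lemma wordDeg_zero : wordDeg k ι 0 = 1 := by
  rw [wordDeg, Submodule.one_eq_span]
  congr 1
  ext x
  simp [FreeMonoid.length_eq_zero, MonoidAlgebra.one_def]

lemma mul_mem_wordDeg {a b : ℕ} {x y : MonoidAlgebra k (FreeMonoid ι)}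
    (hx : x ∈ wordDeg k ι a) (hy : y ∈ wordDeg k ι b) : x * y ∈ wordDeg k ι (a + b) :=
  wordDeg_mul (k := k) a b ▸ Submodule.mul_mem_mul hx hy

lemma coeff_eq_zero_of_mem_wordDeg {m : ℕ} {x : MonoidAlgebra k (FreeMonoid ι)}
    (hx : x ∈ wordDeg k ι m) {w : FreeMonoid ι} (hw : w.length ≠ m) : x.coeff w = 0 := by
  induction hx using Submodule.span_induction with
  | mem x h =>
    obtain ⟨v, hv, rfl⟩ := h
    rw [MonoidAlgebra.coeff_single, Finsupp.single_eq_of_ne]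
    rintro rfl
    exact hw hv
  | zero => simp
  | add x y _ _ hx hy => simp [hx, hy]
  | smul a x _ hx => simp [hx]

/-- The left derivative along the word `v`: it sends `v * w` to `w` and kills all words which
do not start with `v`. -/
noncomputable def wordDeriv (v : FreeMonoid ι) :
    MonoidAlgebra k (FreeMonoid ι) →ₗ[k] MonoidAlgebra k (FreeMonoid ι) where
  toFun x := .ofCoeff (x.coeff.comapDomain (v * ·) (mul_right_injective v).injOn)
  map_add' x y := by ext; simp
  map_smul' r x := by ext; simp

lemma coeff_wordDeriv (v w : FreeMonoid ι) (x : MonoidAlgebra k (FreeMonoid ι)) :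
    (wordDeriv v x).coeff w = x.coeff (v * w) := rfl

lemma wordDeriv_single_mul (v w : FreeMonoid ι) (r : k) :
    wordDeriv v (MonoidAlgebra.single (v * w) r) = MonoidAlgebra.single w r := by
  ext u
  simp [coeff_wordDeriv, MonoidAlgebra.coeff_single, Finsupp.single_apply]

lemma wordDeriv_single_of_ne {v u : FreeMonoid ι} (h : ∀ w, v * w ≠ u) (r : k) :
    wordDeriv v (MonoidAlgebra.single u r) = 0 := by
  ext w
  simp [coeff_wordDeriv, MonoidAlgebra.coeff_single, (h w).symm]

lemma wordDeriv_mul {m : ℕ} {v : FreeMonoid ι} (hv : v.length ≤ m)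
    {c : MonoidAlgebra k (FreeMonoid ι)} (hc : c ∈ wordDeg k ι m)
    (x : MonoidAlgebra k (FreeMonoid ι)) : wordDeriv v (c * x) = wordDeriv v c * x := by
  induction hc using Submodule.span_induction with
  | mem c h =>
    obtain ⟨u, hu, rfl⟩ := h
    induction x using MonoidAlgebra.induction_linear with
    | zero => simp
    | add x y hx hy => simp [mul_add, hx, hy]
    | single y r =>
      rw [MonoidAlgebra.single_mul_single]
      by_cases h : ∃ w, v * w = u
      · obtain ⟨w, rfl⟩ := h
        rw [mul_assoc, wordDeriv_single_mul, wordDeriv_single_mul, MonoidAlgebra.single_mul_single]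
      · push Not at h
        rw [wordDeriv_single_of_ne h, zero_mul, wordDeriv_single_of_ne]
        intro w hw
        have h1 : v.toList <+: u.toList ++ y.toList := ⟨w.toList, hw⟩
        obtain ⟨t, ht⟩ := List.prefix_of_prefix_length_le h1 (List.prefix_append _ _)
          (show v.toList.length ≤ u.toList.length from hv.trans hu.ge)
        exact h (FreeMonoid.ofList t) ht
  | zero => simp
  | add a b _ _ ha hb => simp [add_mul, ha, hb]
  | smul a c _ hc => simp [hc]

lemma wordDeriv_mem {m p : ℕ} {v : FreeMonoid ι} (hv : v.length + p = m)
    {c : MonoidAlgebra k (FreeMonoid ι)} (hc : c ∈ wordDeg k ι m) :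
    wordDeriv v c ∈ wordDeg k ι p := by
  induction hc using Submodule.span_induction with
  | mem c h =>
    obtain ⟨u, hu, rfl⟩ := h
    by_cases h : ∃ w, v * w = u
    · obtain ⟨w, rfl⟩ := h
      rw [wordDeriv_single_mul]
      rw [FreeMonoid.length_mul] at hu
      exact single_mem_wordDeg (by omega) 1
    · push Not at h
      rw [wordDeriv_single_of_ne h]
      exact zero_mem _
  | zero => simp
  | add a b _ _ ha hb => simpa using add_mem ha hb
  | smul a c _ hc => simpa using Submodule.smul_mem _ _ hc

lemma eq_zero_of_wordDeriv_eq_zero {m : ℕ} {c : MonoidAlgebra k (FreeMonoid ι)}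
    (hc : c ∈ wordDeg k ι m) (h : ∀ v : FreeMonoid ι, v.length = m → wordDeriv v c = 0) :
    c = 0 := by
  ext w
  by_cases hw : w.length = m
  · have := congr_arg (fun x => x.coeff 1) (h w hw)
    simpa [coeff_wordDeriv] using this
  · simpa using coeff_eq_zero_of_mem_wordDeg hc hw

variable {G : Type} (α : G → MonoidAlgebra k (FreeMonoid ι) →ₐ[k] MonoidAlgebra k (FreeMonoid ι))

/-- The elements of degree `m` fixed by a family of algebra endomorphisms. -/
noncomputable def fixedDeg (m : ℕ) : Submodule k (MonoidAlgebra k (FreeMonoid ι)) :=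
  wordDeg k ι m ⊓ ⨅ g, LinearMap.eqLocus (α g).toLinearMap LinearMap.id

lemma mem_fixedDeg {m : ℕ} {x : MonoidAlgebra k (FreeMonoid ι)} :
    x ∈ fixedDeg α m ↔ x ∈ wordDeg k ι m ∧ ∀ g, α g x = x := by
  simp [fixedDeg]

lemma fixedDeg_mul_le (a b : ℕ) : fixedDeg α a * fixedDeg α b ≤ fixedDeg α (a + b) := by
  rw [Submodule.mul_le]
  intro x hx y hy
  rw [mem_fixedDeg] at *
  exact ⟨mul_mem_wordDeg hx.1 hy.1, fun g => by rw [map_mul, hx.2, hy.2]⟩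

/-- The span of the products of fixed elements of positive degrees with total degree `m`. -/
noncomputable def compositeDeg (m : ℕ) : Submodule k (MonoidAlgebra k (FreeMonoid ι)) :=
  Submodule.span k {x | ∃ a b : ℕ, a + b = m ∧ 0 < a ∧ 0 < b ∧
    ∃ u ∈ fixedDeg α a, ∃ w ∈ fixedDeg α b, x = u * w}

/-- Homogeneous fixed elements which are linearly independent modulo composite elements are
left linearly independent over the whole algebra of noncommutative polynomials. -/
theorem eq_zero_of_sum_mul_eq_zero
    (hα : ∀ g m x, x ∈ wordDeg k ι m → α g x ∈ wordDeg k ι m)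
    {X : Type} (deg : X → ℕ) (β : X → MonoidAlgebra k (FreeMonoid ι))
    (hβ : ∀ x, β x ∈ fixedDeg α (deg x))
    (hind : ∀ (b : ℕ) (s : Finset X) (a : X → k), 0 < b → (∀ x ∈ s, deg x = b) →
      ∑ x ∈ s, a x • β x ∈ compositeDeg α b → ∀ x ∈ s, a x = 0)
    (B n : ℕ) (s : Finset X) (c : X → MonoidAlgebra k (FreeMonoid ι))
    (hpos : ∀ x ∈ s, 0 < deg x) (hB : ∀ x ∈ s, deg x < B)
    (hc : ∀ x ∈ s, ∃ m, m + deg x = n ∧ c x ∈ wordDeg k ι m)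
    (h0 : ∑ x ∈ s, c x * β x = 0) : ∀ x ∈ s, c x = 0 := by
  induction B generalizing n s c with
  | zero => exact fun x hx => absurd (hB x hx) (by omega)
  | succ B ih =>
    set t := s.filter (deg · = B)
    set r := s.filter (¬ deg · = B)
    have htr : ∑ x ∈ t, c x * β x + ∑ x ∈ r, c x * β x = 0 := by
      rw [← h0]; exact Finset.sum_filter_add_sum_filter_not _ _ _
    have hts : ∀ x ∈ t, x ∈ s ∧ deg x = B := fun x hx => Finset.mem_filter.1 hx
    have hrs : ∀ x ∈ r, x ∈ s ∧ deg x < B := fun x hx => by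
      have h1 := Finset.mem_filter.1 hx
      have h2 := hB x h1.1
      exact ⟨h1.1, by omega⟩
    have htop : ∀ x ∈ t, c x = 0 := by
      intro x₀ hx₀
      obtain ⟨m, hm, hcm⟩ := hc x₀ (hts x₀ hx₀).1
      have hBpos : 0 < B := (hts x₀ hx₀).2 ▸ hpos x₀ (hts x₀ hx₀).1
      rw [(hts x₀ hx₀).2] at hm
      have hct : ∀ x ∈ t, c x ∈ wordDeg k ι m := fun x hx => by
        obtain ⟨m', h1, h2⟩ := hc x (hts x hx).1
        rw [(hts x hx).2] at h1
        obtain rfl : m' = m := by omega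
        exact h2
      have hcr : ∀ x ∈ r, ∃ p, p + deg x = B ∧ c x ∈ wordDeg k ι (m + p) := fun x hx => by
        obtain ⟨m', h1, h2⟩ := hc x (hrs x hx).1
        have h3 := (hrs x hx).2
        obtain rfl : m' = m + (B - deg x) := by omega
        exact ⟨_, by omega, h2⟩
      refine eq_zero_of_wordDeriv_eq_zero hcm fun v hv => ?_
      have hscal : ∀ x ∈ t, wordDeriv v (c x) = algebraMap k _ ((c x).coeff v) := fun x hx => by
        have h1 : wordDeriv v (c x) ∈ wordDeg k ι 0 := wordDeriv_mem (by omega) (hct x hx)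
        rw [wordDeg_zero, Submodule.mem_one] at h1
        obtain ⟨a, ha⟩ := h1
        have h2 : (wordDeriv v (c x)).coeff 1 = a := by rw [← ha]; simp
        rw [coeff_wordDeriv, mul_one] at h2
        rw [h2, ha]
      have hderiv : ∑ x ∈ t, (c x).coeff v • β x + ∑ x ∈ r, wordDeriv v (c x) * β x = 0 := by
        have h1 := congr_arg (wordDeriv v) htr
        rw [map_add, map_sum, map_sum, map_zero] at h1
        rw [← h1]
        congr 1
        · refine Finset.sum_congr rfl fun x hx => ?_
          rw [wordDeriv_mul hv.le (hct x hx), hscal x hx, Algebra.smul_def]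
        · refine Finset.sum_congr rfl fun x hx => ?_
          obtain ⟨p, _, hp⟩ := hcr x hx
          rw [wordDeriv_mul (by omega) hp]
      have hdeg : ∀ x ∈ r, ∃ p, p + deg x = B ∧ wordDeriv v (c x) ∈ wordDeg k ι p :=
        fun x hx => by
          obtain ⟨p, h1, h2⟩ := hcr x hx
          exact ⟨p, h1, wordDeriv_mem (by omega) h2⟩
      have hfix : ∀ g, ∀ x ∈ r, α g (wordDeriv v (c x)) = wordDeriv v (c x) := by
        intro g x hx
        refine sub_eq_zero.1 (ih B r (fun x => α g (wordDeriv v (c x)) - wordDeriv v (c x))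
          (fun x hx => hpos x (hrs x hx).1) (fun x hx => (hrs x hx).2) (fun x hx => ?_) ?_ x hx)
        · obtain ⟨p, h1, h2⟩ := hdeg x hx
          exact ⟨p, h1, sub_mem (hα g p _ h2) h2⟩
        · have h1 := congr_arg (α g) hderiv
          rw [map_add, map_sum, map_sum, map_zero] at h1
          have hβg : ∀ x, α g (β x) = β x := fun x => ((mem_fixedDeg α).1 (hβ x)).2 g
          simp only [map_smul, map_mul, hβg] at h1
          simp only [sub_mul, Finset.sum_sub_distrib]
          rw [sub_eq_zero]
          exact add_left_cancel (h1.trans hderiv.symm)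
      have hcomp : ∑ x ∈ t, (c x).coeff v • β x ∈ compositeDeg α B := by
        rw [eq_neg_of_add_eq_zero_left hderiv]
        refine neg_mem (sum_mem fun x hx => ?_)
        obtain ⟨p, h1, h2⟩ := hdeg x hx
        have h3 := (hrs x hx).2
        exact Submodule.subset_span ⟨p, deg x, h1, by omega, hpos x (hrs x hx).1, _,
          (mem_fixedDeg α).2 ⟨h2, fun g => hfix g x hx⟩, _, hβ x, rfl⟩
      rw [hscal x₀ hx₀, hind B t _ hBpos (fun x hx => (hts x hx).2) hcomp x₀ hx₀, map_zero]
    have hlow : ∀ x ∈ r, c x = 0 := by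
      refine ih n r c (fun x hx => hpos x (hrs x hx).1) (fun x hx => (hrs x hx).2)
        (fun x hx => hc x (hrs x hx).1) ?_
      rwa [Finset.sum_eq_zero fun x hx => by rw [htop x hx, zero_mul], zero_add] at htr
    intro x hx
    by_cases h : deg x = B
    · exact htop x (Finset.mem_filter.2 ⟨hx, h⟩)
    · exact hlow x (Finset.mem_filter.2 ⟨hx, h⟩)

end Words

/-! ### Strings of a constant sequence as noncommutative polynomials -/

section Realization

variable {k G M₀ ι : Type} [Field k] [Group G] [AddCommGroup M₀] [Module k M₀]

/-- Adjoining a tensor factor at the bottom of a string. -/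
noncomputable def strCons (i m : ℕ) : ↥(Str (k := k) (fun _ => M₀) (i + 1) m) →ₗ[k] M₀ →ₗ[k]
    ↥(Str (k := k) (fun _ => M₀) i (m + 1)) :=
  TensorProduct.mk k ↥(Str (k := k) (fun _ => M₀) (i + 1) m) M₀

lemma str_succ_induction {i m : ℕ} {p : ↥(Str (k := k) (fun _ => M₀) i (m + 1)) → Prop}
    (zero : p 0) (cons : ∀ x y, p (strCons i m x y)) (add : ∀ x y, p x → p y → p (x + y))
    (x : ↥(Str (k := k) (fun _ => M₀) i (m + 1))) : p x :=
  TensorProduct.induction_on (motive := p) x zero cons add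

section Algebra

variable {A : Type} [Ring A] [Algebra k A] (L : M₀ →ₗ[k] A)

/-- The map from strings of a constant sequence to an algebra induced by a linear map. -/
noncomputable def strLift : ∀ i m : ℕ, ↥(Str (k := k) (fun _ => M₀) i m) →ₗ[k] A
  | _, 0 => Algebra.linearMap k A
  | i, m + 1 => TensorProduct.lift ((LinearMap.mul k A).compl₁₂ (strLift (i + 1) m) L)

lemma strLift_strCons (i m : ℕ) (x : ↥(Str (k := k) (fun _ => M₀) (i + 1) m)) (y : M₀) :
    strLift L i (m + 1) (strCons i m x y) =
      strLift L (i + 1) m x * L y := rfl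

lemma strLift_strCast {i j : ℕ} (h : i = j) (m : ℕ) (x : ↥(Str (k := k) (fun _ => M₀) i m)) :
    strLift L j m (strCast (fun _ => M₀) h m x) = strLift L i m x := by
  subst h; rfl

lemma strLift_strCastLen {i m m' : ℕ} (h : m = m') (x : ↥(Str (k := k) (fun _ => M₀) i m)) :
    strLift L i m' (strCastLen (fun _ => M₀) h x) = strLift L i m x := by
  subst h; rfl

lemma strLift_strMul (a b i : ℕ) (u : ↥(Str (k := k) (fun _ => M₀) (i + b) a))
    (w : ↥(Str (k := k) (fun _ => M₀) i b)) :
    strLift L i (a + b) (strMul (fun _ => M₀) a b i u w) =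
      strLift L (i + b) a u * strLift L i b w := by
  induction b generalizing i with
  | zero =>
    change strLift L i a ((show k from w) • u) = strLift L i a u * algebraMap k A w
    rw [map_smul, Algebra.smul_def, Algebra.commutes]
  | succ b ih =>
    induction w using str_succ_induction with
    | zero => simp only [map_zero, mul_zero]
    | cons x y =>
      change strLift L (i + 1) (a + b) (strMul (fun _ => M₀) a b (i + 1)
        (strCast (fun _ => M₀) _ a u) x) * L y = _ * (strLift L (i + 1) b x * L y)
      rw [ih, strLift_strCast, mul_assoc]
    | add x y hx hy =>
      rw [map_add, map_add, map_add, hx, hy, mul_add]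

lemma strLift_strAct (ρ : Representation k G M₀) (α : A →ₐ[k] A) (g : G)
    (h : ∀ y, α (L y) = L (ρ g y)) (i m : ℕ) (x : ↥(Str (k := k) (fun _ => M₀) i m)) :
    strLift L i m (strAct (fun _ => M₀) (fun _ => ρ) i m g x) = α (strLift L i m x) := by
  induction m generalizing i with
  | zero => exact (α.commutes _).symm
  | succ m ih =>
    induction x using str_succ_induction with
    | zero => rw [map_zero, map_zero, map_zero]
    | cons x y =>
      change strLift L (i + 1) m (strAct (fun _ => M₀) (fun _ => ρ) (i + 1) m g x) * L (ρ g y) =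
        α (strLift L (i + 1) m x * L y)
      rw [ih, map_mul, h]
    | add x y hx hy => rw [map_add, map_add, map_add, map_add, hx, hy]

end Algebra

variable (b : Module.Basis ι k M₀)

/-- The linear map sending each basis vector to the corresponding letter. -/
noncomputable def letter : M₀ →ₗ[k] MonoidAlgebra k (FreeMonoid ι) :=
  b.constr k fun j => MonoidAlgebra.single (FreeMonoid.of j) 1

lemma letter_basis (j : ι) : letter b (b j) = MonoidAlgebra.single (FreeMonoid.of j) 1 :=
  b.constr_basis _ _ _

lemma range_letter : LinearMap.range (letter b) = wordDeg k ι 1 := by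
  rw [letter, Module.Basis.constr_range, wordDeg]
  congr 1
  ext x
  simp only [Set.mem_range, FreeMonoid.length_eq_one, Set.mem_ofPred_eq]
  constructor
  · rintro ⟨j, rfl⟩
    exact ⟨_, ⟨j, rfl⟩, rfl⟩
  · rintro ⟨_, ⟨j, rfl⟩, rfl⟩
    exact ⟨j, rfl⟩

lemma range_strLift_succ (i m : ℕ) : LinearMap.range (strLift (letter b) i (m + 1)) =
    LinearMap.range (strLift (letter b) (i + 1) m) * LinearMap.range (letter b) := by
  apply le_antisymm
  · rintro _ ⟨x, rfl⟩
    induction x using str_succ_induction with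
    | zero => rw [map_zero]; exact zero_mem _
    | cons x y => exact Submodule.mul_mem_mul ⟨x, rfl⟩ ⟨y, rfl⟩
    | add x y hx hy => rw [map_add]; exact add_mem hx hy
  · rw [Submodule.mul_le]
    rintro _ ⟨x, rfl⟩ _ ⟨y, rfl⟩
    exact ⟨strCons i m x y, rfl⟩

lemma range_strLift (i m : ℕ) :
    LinearMap.range (strLift (letter b) i m) = wordDeg k ι m := by
  induction m generalizing i with
  | zero => rw [wordDeg_zero, Submodule.one_eq_range]; rfl
  | succ m ih => rw [range_strLift_succ, ih, range_letter, wordDeg_mul]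

lemma strLift_injective (i m : ℕ) : Function.Injective (strLift (letter b) i m) := by
  induction m generalizing i with
  | zero => exact (algebraMap k (MonoidAlgebra k (FreeMonoid ι))).injective
  | succ m ih =>
    rw [injective_iff_map_eq_zero]
    intro x hx
    obtain ⟨f, rfl⟩ := (TensorProduct.equivFinsuppOfBasisRight (R := k)
      (M := ↥(Str (k := k) (fun _ => M₀) (i + 1) m)) b).symm.surjective x
    suffices f = 0 by rw [this]; exact map_zero _
    rw [TensorProduct.equivFinsuppOfBasisRight_symm_apply, Finsupp.sum] at hx
    have hx' : ∑ j ∈ f.support, strLift (letter b) (i + 1) m (f j) *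
        MonoidAlgebra.single (FreeMonoid.of j) 1 = 0 := by
      rw [← hx]
      refine Eq.trans ?_ (map_sum (strLift (letter b) i (m + 1)) _ _).symm
      exact Finset.sum_congr rfl fun j _ => by
        rw [← letter_basis b]; exact (strLift_strCons (letter b) i m _ _).symm
    ext j
    apply ih
    rw [Finsupp.zero_apply, map_zero]
    by_cases hj : j ∈ f.support
    · ext w
      have h := congr_arg (fun x => x.coeff (w * FreeMonoid.of j)) hx'
      simp only [MonoidAlgebra.coeff_sum, Finsupp.finsetSum_apply] at h
      rw [Finset.sum_eq_single_of_mem j hj] at h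
      · rwa [MonoidAlgebra.coeff_mul_single_eq_coeff_mul w (by simp), mul_one] at h
      · intro j' _ hne
        apply MonoidAlgebra.coeff_mul_single_of_forall_mul_ne
        intro d hd
        have : d.toList ++ [j'] = w.toList ++ [j] := hd
        exact hne (by simpa using (List.append_inj' this rfl).2)
    · rw [Finsupp.notMem_support_iff.1 hj, map_zero]

instance finite_str [FiniteDimensional k M₀] (i m : ℕ) :
    FiniteDimensional k ↥(Str (k := k) (fun _ => M₀) i m) := by
  induction m generalizing i with
  | zero => exact inferInstanceAs (FiniteDimensional k k)
  | succ m ih =>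
    exact inferInstanceAs
      (FiniteDimensional k (↥(Str (k := k) (fun _ => M₀) (i + 1) m) ⊗[k] M₀))

variable (ρ : Representation k G M₀)

/-- The diagonal action on noncommutative polynomials. -/
noncomputable def wordAct (g : G) :
    MonoidAlgebra k (FreeMonoid ι) →ₐ[k] MonoidAlgebra k (FreeMonoid ι) :=
  MonoidAlgebra.lift k _ _ (FreeMonoid.lift fun j => letter b (ρ g (b j)))

lemma wordAct_letter (g : G) (y : M₀) : wordAct b ρ g (letter b y) = letter b (ρ g y) := by
  have : (wordAct b ρ g).toLinearMap ∘ₗ letter b = letter b ∘ₗ ρ g :=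
    b.ext fun j => by simp [letter_basis, wordAct]
  exact LinearMap.congr_fun this y

lemma strLift_strAct_eq_wordAct (i m : ℕ) (g : G) (x : ↥(Str (k := k) (fun _ => M₀) i m)) :
    strLift (letter b) i m (strAct (fun _ => M₀) (fun _ => ρ) i m g x) =
      wordAct b ρ g (strLift (letter b) i m x) :=
  strLift_strAct _ ρ _ g (wordAct_letter b ρ g) i m x

lemma wordAct_mem_wordDeg (g : G) (m : ℕ) (x : MonoidAlgebra k (FreeMonoid ι))
    (hx : x ∈ wordDeg k ι m) : wordAct b ρ g x ∈ wordDeg k ι m := by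
  rw [← range_strLift b 0 m] at hx ⊢
  obtain ⟨y, rfl⟩ := hx
  exact ⟨_, strLift_strAct_eq_wordAct b ρ 0 m g y⟩

lemma mem_strInv_iff (i m : ℕ) (x : ↥(Str (k := k) (fun _ => M₀) i m)) :
    x ∈ strInv (fun _ => M₀) (fun _ => ρ) i m ↔
      strLift (letter b) i m x ∈ fixedDeg (wordAct b ρ) m := by
  rw [mem_fixedDeg, ← range_strLift b i m, and_iff_right (LinearMap.mem_range_self _ _)]
  simp only [strInv, Submodule.mem_iInf, LinearMap.mem_eqLocus, LinearMap.id_apply,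
    ← strLift_strAct_eq_wordAct, (strLift_injective b i m).eq_iff]

lemma map_strInv (i m : ℕ) : (strInv (fun _ => M₀) (fun _ => ρ) i m).map (strLift (letter b) i m) =
    fixedDeg (wordAct b ρ) m := by
  ext x
  constructor
  · rintro ⟨y, hy, rfl⟩
    exact (mem_strInv_iff b ρ i m y).1 hy
  · intro hx
    obtain ⟨y, rfl⟩ : x ∈ LinearMap.range (strLift (letter b) i m) :=
      range_strLift b i m ▸ ((mem_fixedDeg _).1 hx).1
    exact ⟨y, (mem_strInv_iff b ρ i m y).2 hx, rfl⟩

lemma map_strComp (i m : ℕ) : (strComp (fun _ => M₀) (fun _ => ρ) i m).map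
    (strLift (letter b) i m) = compositeDeg (wordAct b ρ) m := by
  rw [strComp, Submodule.map_span, compositeDeg]
  congr 1
  ext x
  constructor
  · rintro ⟨_, ⟨c, d, rfl, hc, hd, u, hu, w, hw, rfl⟩, rfl⟩
    exact ⟨c, d, rfl, hc, hd, _, (mem_strInv_iff b ρ _ _ u).1 hu, _,
      (mem_strInv_iff b ρ _ _ w).1 hw, by rw [strLift_strCastLen, strLift_strMul]⟩
  · rintro ⟨c, d, rfl, hc, hd, u, hu, w, hw, rfl⟩
    rw [← map_strInv b ρ (i + d) c] at hu
    rw [← map_strInv b ρ i d] at hw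
    obtain ⟨u, hu, rfl⟩ := hu
    obtain ⟨w, hw, rfl⟩ := hw
    exact ⟨_, ⟨c, d, rfl, hc, hd, u, hu, w, hw, rfl⟩, by
      rw [strLift_strCastLen, strLift_strMul]⟩

end Realization

section DirectSum

variable {k X W : Type} [Field k] {N : X → Type} [∀ p, AddCommGroup (N p)] [∀ p, Module k (N p)]
  [AddCommGroup W] [Module k W] (f : ∀ p, N p →ₗ[k] W)

lemma toModule_injective
    (h : ∀ (s : Finset X) (x : ∀ p, N p), ∑ p ∈ s, f p (x p) = 0 → ∀ p ∈ s, x p = 0) :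
    Function.Injective (DirectSum.toModule k X W f) := by
  rw [injective_iff_map_eq_zero]
  intro x hx
  have h0 : ∑ p ∈ DFinsupp.support x, f p (x p) = 0 := by
    rw [← hx]
    conv_rhs => rw [← DirectSum.sum_support_of x]
    rw [map_sum]
    exact Finset.sum_congr rfl fun p _ => (DirectSum.toModule_lof k p (x p)).symm
  refine DFinsupp.ext fun p => ?_
  by_cases hp : p ∈ DFinsupp.support x
  · exact h _ _ h0 p hp
  · exact DFinsupp.notMem_support_iff.1 hp

lemma range_toModule :
    LinearMap.range (DirectSum.toModule k X W f) = ⨆ p, LinearMap.range (f p) := by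
  apply le_antisymm
  · rintro _ ⟨x, rfl⟩
    induction x using DirectSum.induction_on with
    | zero => rw [map_zero]; exact zero_mem _
    | of p x =>
      rw [show DirectSum.toModule k X W f (DirectSum.of N p x) = f p x from
        DirectSum.toModule_lof k p x]
      exact Submodule.mem_iSup_of_mem p ⟨x, rfl⟩
    | add x y hx hy => rw [map_add]; exact add_mem hx hy
  · refine iSup_le fun p => ?_
    rintro _ ⟨x, rfl⟩
    exact ⟨DirectSum.lof k X N p x, DirectSum.toModule_lof k p x⟩

end DirectSum

/-! ### Products of irreducible invariants along partitions -/

section Partitions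

variable {k G M₀ ι : Type} [Field k] [Group G] [AddCommGroup M₀] [Module k M₀]
variable (Irr : ∀ i m : ℕ, Submodule k ↥(Str (k := k) (fun _ => M₀) i m))

/-- Adjoining an irreducible factor at the bottom. -/
noncomputable def tIrrCons (i a : ℕ) (l : List ℕ) :
    ↥(TIrr (k := k) (fun _ => M₀) Irr (i + a) l) →ₗ[k] ↥(Irr i a) →ₗ[k]
      ↥(TIrr (k := k) (fun _ => M₀) Irr i (a :: l)) :=
  TensorProduct.mk k ↥(TIrr (k := k) (fun _ => M₀) Irr (i + a) l) ↥(Irr i a)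

lemma tIrr_cons_induction {i a : ℕ} {l : List ℕ}
    {p : ↥(TIrr (k := k) (fun _ => M₀) Irr i (a :: l)) → Prop}
    (zero : p 0) (cons : ∀ x y, p (tIrrCons Irr i a l x y)) (add : ∀ x y, p x → p y → p (x + y))
    (x : ↥(TIrr (k := k) (fun _ => M₀) Irr i (a :: l))) : p x :=
  TensorProduct.induction_on (motive := p) x zero cons add

/-- Coordinates with respect to a basis of the bottom irreducible factor. -/
noncomputable def tIrrCoord {i a : ℕ} {J : Type} (c : Module.Basis J k ↥(Irr i a)) (l : List ℕ) :
    ↥(TIrr (k := k) (fun _ => M₀) Irr i (a :: l)) ≃ₗ[k]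
      (J →₀ ↥(TIrr (k := k) (fun _ => M₀) Irr (i + a) l)) :=
  TensorProduct.equivFinsuppOfBasisRight c

lemma sum_tIrrCoord {i a : ℕ} {J : Type} [Fintype J] (c : Module.Basis J k ↥(Irr i a)) (l : List ℕ)
    (x : ↥(TIrr (k := k) (fun _ => M₀) Irr i (a :: l))) :
    ∑ j, tIrrCons Irr i a l (tIrrCoord Irr c l x j) (c j) = x := by
  have h : (tIrrCoord Irr c l).symm (tIrrCoord Irr c l x) =
      (tIrrCoord Irr c l x).sum fun j u => tIrrCons Irr i a l u (c j) :=
    TensorProduct.equivFinsuppOfBasisRight_symm_apply c _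
  rw [LinearEquiv.symm_apply_apply, Finsupp.sum_fintype _ _ (by simp)] at h
  exact h.symm

variable (b : Module.Basis ι k M₀)

/-- The product along a partition, as a noncommutative polynomial. -/
noncomputable def partLift (i : ℕ) (l : List ℕ) :
    ↥(TIrr (k := k) (fun _ => M₀) Irr i l) →ₗ[k] MonoidAlgebra k (FreeMonoid ι) :=
  strLift (letter b) i l.sum ∘ₗ iotaT (fun _ => M₀) Irr i l

lemma partLift_tIrrCons (i a : ℕ) (l : List ℕ)
    (x : ↥(TIrr (k := k) (fun _ => M₀) Irr (i + a) l)) (y : ↥(Irr i a)) :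
    partLift Irr b i (a :: l) (tIrrCons Irr i a l x y) =
      partLift Irr b (i + a) l x * strLift (letter b) i a y := by
  change strLift (letter b) i (a + l.sum) (strCastLen (fun _ => M₀) _
    (strMul (fun _ => M₀) l.sum a i (iotaT (fun _ => M₀) Irr (i + a) l x) y)) = _
  rw [strLift_strCastLen, strLift_strMul]
  rfl

lemma partLift_mem (i : ℕ) (l : List ℕ) (x : ↥(TIrr (k := k) (fun _ => M₀) Irr i l)) :
    partLift Irr b i l x ∈ wordDeg k ι l.sum :=
  range_strLift b i l.sum ▸ LinearMap.mem_range_self _ _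

lemma partLift_nil_injective (i : ℕ) : Function.Injective (partLift Irr b i []) :=
  (algebraMap k (MonoidAlgebra k (FreeMonoid ι))).injective

lemma range_partLift_nil (i : ℕ) : LinearMap.range (partLift Irr b i []) = 1 := by
  rw [Submodule.one_eq_range]; rfl

lemma range_partLift_cons (i a : ℕ) (l : List ℕ) : LinearMap.range (partLift Irr b i (a :: l)) =
    LinearMap.range (partLift Irr b (i + a) l) * (Irr i a).map (strLift (letter b) i a) := by
  apply le_antisymm
  · rintro _ ⟨x, rfl⟩
    induction x using tIrr_cons_induction with
    | zero => rw [map_zero]; exact zero_mem _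
    | cons x y =>
      rw [partLift_tIrrCons]
      exact Submodule.mul_mem_mul ⟨x, rfl⟩ ⟨y, y.2, rfl⟩
    | add x y hx hy => rw [map_add]; exact add_mem hx hy
  · rw [Submodule.mul_le]
    rintro _ ⟨x, rfl⟩ _ ⟨y, hy, rfl⟩
    exact ⟨tIrrCons Irr i a l x ⟨y, hy⟩, partLift_tIrrCons Irr b i a l x ⟨y, hy⟩⟩

lemma range_partLift_append (i : ℕ) (l l' : List ℕ) :
    LinearMap.range (partLift Irr b i (l ++ l')) =
      LinearMap.range (partLift Irr b (i + l.sum) l') * LinearMap.range (partLift Irr b i l) := by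
  induction l generalizing i with
  | nil => rw [range_partLift_nil, mul_one]; rfl
  | cons a l ih =>
    rw [List.cons_append, range_partLift_cons, ih, range_partLift_cons, List.sum_cons, mul_assoc,
      add_assoc]

variable (ρ : Representation k G M₀)

/-- The spaces `Irr i m` are complements of the composite invariants in all invariants. -/
def IsIrreducibleChoice : Prop :=
  ∀ i m : ℕ, 0 < m →
    strComp (fun _ => M₀) (fun _ => ρ) i m ⊓ Irr i m = ⊥ ∧
    strComp (fun _ => M₀) (fun _ => ρ) i m ⊔ Irr i m = strInv (fun _ => M₀) (fun _ => ρ) i m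

variable {Irr ρ}

lemma compositeDeg_sup_map_irr (hIrr : IsIrreducibleChoice Irr ρ) (i : ℕ) {m : ℕ} (hm : 0 < m) :
    compositeDeg (wordAct b ρ) m ⊔ (Irr i m).map (strLift (letter b) i m) =
      fixedDeg (wordAct b ρ) m := by
  rw [← map_strComp b ρ i m, ← map_strInv b ρ i m, ← (hIrr i m hm).2, Submodule.map_sup]

lemma range_partLift_le (hIrr : IsIrreducibleChoice Irr ρ)
    (i : ℕ) (l : List ℕ) (hl : ∀ a ∈ l, 0 < a) :
    LinearMap.range (partLift Irr b i l) ≤ fixedDeg (wordAct b ρ) l.sum := by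
  induction l generalizing i with
  | nil =>
    rintro _ ⟨x, rfl⟩
    exact (mem_fixedDeg _).2 ⟨partLift_mem Irr b i [] x, fun g => AlgHom.commutes _ _⟩
  | cons a l ih =>
    rw [range_partLift_cons, List.sum_cons, add_comm a l.sum]
    have h : (Irr i a).map (strLift (letter b) i a) ≤ fixedDeg (wordAct b ρ) a :=
      le_sup_right.trans (compositeDeg_sup_map_irr b hIrr i (hl a List.mem_cons_self)).le
    exact (mul_le_mul' (ih _ fun c hc => hl c (List.mem_cons_of_mem _ hc)) h).trans
      (fixedDeg_mul_le _ _ _)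

lemma fixedDeg_le_iSup (hIrr : IsIrreducibleChoice Irr ρ) (i n : ℕ) :
    fixedDeg (wordAct b ρ) n ≤ ⨆ p : Pt n, LinearMap.range (partLift Irr b i p.1) := by
  induction n using Nat.strong_induction_on generalizing i with
  | _ n ih =>
  rcases Nat.eq_zero_or_pos n with rfl | hn
  · refine le_trans ?_ (le_iSup _ (⟨[], rfl, by simp⟩ : Pt 0))
    rw [range_partLift_nil, ← wordDeg_zero]
    exact inf_le_left
  · rw [← compositeDeg_sup_map_irr b hIrr i hn]
    refine sup_le ?_ ?_
    · rw [compositeDeg, Submodule.span_le]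
      rintro _ ⟨c, d, hcd, hc, hd, u, hu, w, hw, rfl⟩
      have hmul := Submodule.mul_mem_mul (ih c (by omega) (i + d) hu) (ih d (by omega) i hw)
      rw [Submodule.iSup_mul] at hmul
      refine (show _ ≤ (_ : Submodule k _) from iSup_le fun q => ?_) hmul
      rw [Submodule.mul_iSup]
      refine iSup_le fun p => ?_
      have hsum : (p.1 ++ q.1).sum = n := by
        rw [List.sum_append, p.2.1, q.2.1]; omega
      refine le_trans (le_of_eq ?_) (le_iSup _ (⟨p.1 ++ q.1, hsum, fun a ha =>
        (List.mem_append.1 ha).elim (p.2.2 a) (q.2.2 a)⟩ : Pt n))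
      rw [range_partLift_append, p.2.1]
    · refine le_trans (le_of_eq ?_) (le_iSup _ (⟨[n], by simp, by simpa⟩ : Pt n))
      rw [range_partLift_cons, range_partLift_nil, one_mul]

lemma sum_eq_sum_ite_of_fst_eq {A : Type} [AddCommMonoid A] {J : ℕ → Type} [∀ a, Fintype (J a)]
    {m : ℕ} (t : Finset (Σ a, J a)) (ht : ∀ z ∈ t, z.1 = m) (f : (Σ a, J a) → A) :
    ∑ z ∈ t, f z = ∑ j : J m, if ⟨m, j⟩ ∈ t then f ⟨m, j⟩ else 0 := by
  rw [← Finset.sum_filter]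
  symm
  refine Finset.sum_bij (fun j _ => ⟨m, j⟩) (fun j hj => (Finset.mem_filter.1 hj).2)
    (fun j _ j' _ h => by simpa using h) ?_ fun _ _ => rfl
  rintro ⟨a, j⟩ hz
  obtain rfl : a = m := ht _ hz
  exact ⟨j, by simpa using hz, rfl⟩

lemma sum_sum_cons {A : Type} [AddCommMonoid A] {n : ℕ} (s : Finset (List ℕ))
    (hs : ∀ l ∈ s, 0 < l.sum ∧ l.sum ≤ n ∧ ∀ a ∈ l, 0 < a) (f : List ℕ → A) :
    ∑ a ∈ Finset.Icc 1 n, ∑ l ∈ s.preimage (List.cons a) List.cons_injective.injOn, f (a :: l) =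
      ∑ l ∈ s, f l := by
  rw [Finset.sum_sigma']
  refine Finset.sum_bij (fun z _ => z.1 :: z.2) ?_ ?_ ?_ fun _ _ => rfl
  · rintro ⟨a, l⟩ hz
    exact Finset.mem_preimage.1 (Finset.mem_sigma.1 hz).2
  · rintro ⟨a, l⟩ _ ⟨a', l'⟩ _ h
    obtain ⟨rfl, rfl⟩ := List.cons.inj h
    rfl
  · intro l hl
    obtain ⟨h1, h2, h3⟩ := hs l hl
    rcases l with _ | ⟨a, l⟩
    · simp at h1
    · have ha := h3 a List.mem_cons_self
      rw [List.sum_cons] at h2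
      exact ⟨⟨a, l⟩, Finset.mem_sigma.2 ⟨Finset.mem_Icc.2 ⟨ha, (Nat.le_add_right _ _).trans h2⟩,
        Finset.mem_preimage.2 hl⟩, rfl⟩

lemma eq_zero_of_sum_mem_compositeDeg (hIrr : IsIrreducibleChoice Irr ρ) (i : ℕ) {m : ℕ}
    (hm : 0 < m) {J : ℕ → Type} [∀ a, Fintype (J a)] (c : ∀ a, Module.Basis (J a) k ↥(Irr i a))
    (t : Finset (Σ a, J a)) (ht : ∀ z ∈ t, z.1 = m) (a : (Σ a, J a) → k)
    (hmem : ∑ z ∈ t, a z • strLift (letter b) i z.1 (c z.1 z.2) ∈ compositeDeg (wordAct b ρ) m) :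
    ∀ z ∈ t, a z = 0 := by
  let d : J m → k := fun j => if ⟨m, j⟩ ∈ t then a ⟨m, j⟩ else 0
  have hd : strLift (letter b) i m ((∑ j, d j • c m j : ↥(Irr i m)) : ↥(Str (k := k) (fun _ => M₀) i m)) =
      ∑ z ∈ t, a z • strLift (letter b) i z.1 (c z.1 z.2) := by
    rw [sum_eq_sum_ite_of_fst_eq t ht, Submodule.coe_sum, map_sum]
    refine Finset.sum_congr rfl fun j _ => ?_
    rw [Submodule.coe_smul, map_smul, ite_zero_smul]
  rw [← hd, ← map_strComp b ρ i m] at hmem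
  obtain ⟨y, hy, hy'⟩ := hmem
  obtain rfl := strLift_injective b i m hy'
  have h0 : ((∑ j, d j • c m j : ↥(Irr i m)) : ↥(Str (k := k) (fun _ => M₀) i m)) ∈
      strComp (fun _ => M₀) (fun _ => ρ) i m ⊓ Irr i m := ⟨hy, Subtype.prop _⟩
  rw [(hIrr i m hm).1, Submodule.mem_bot, Submodule.coe_eq_zero] at h0
  rintro ⟨m', j⟩ hz
  obtain rfl : m' = m := ht _ hz
  simpa [d, hz] using Fintype.linearIndependent_iff.1 (c m').linearIndependent d h0 j

theorem eq_zero_of_sum_partLift_eq_zero [FiniteDimensional k M₀]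
    (hIrr : IsIrreducibleChoice Irr ρ) (n i : ℕ) (s : Finset (List ℕ))
    (hs : ∀ l ∈ s, l.sum = n ∧ ∀ a ∈ l, 0 < a)
    (x : ∀ l, ↥(TIrr (k := k) (fun _ => M₀) Irr i l))
    (h0 : ∑ l ∈ s, partLift Irr b i l (x l) = 0) : ∀ l ∈ s, x l = 0 := by
  induction n using Nat.strong_induction_on generalizing i s with
  | _ n ih =>
  rcases Nat.eq_zero_or_pos n with rfl | hn
  · intro l hl
    have hnil : ∀ l ∈ s, l = [] := fun l hl => by
      rcases l with _ | ⟨a, l⟩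
      · rfl
      · have h1 := (hs _ hl).1
        have h2 := (hs _ hl).2 a List.mem_cons_self
        rw [List.sum_cons] at h1
        omega
    obtain rfl := hnil l hl
    rw [Finset.sum_eq_single_of_mem [] hl fun l' hl' hne => absurd (hnil l' hl') hne] at h0
    exact partLift_nil_injective Irr b i (h0.trans (map_zero _).symm)
  let J : ℕ → Type := fun a => Fin (Module.finrank k ↥(Irr i a))
  let c : ∀ a, Module.Basis (J a) k ↥(Irr i a) := fun a => Module.finBasis k _
  let tails : ℕ → Finset (List ℕ) := fun a =>
    s.preimage (List.cons a) (List.cons_injective.injOn)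
  have htails : ∀ a l, l ∈ tails a ↔ a :: l ∈ s := fun a l => Finset.mem_preimage
  let coef : (Σ a, J a) → MonoidAlgebra k (FreeMonoid ι) := fun z =>
    ∑ l ∈ tails z.1, partLift Irr b (i + z.1) l (tIrrCoord Irr (c z.1) l (x (z.1 :: l)) z.2)
  let β : (Σ a, J a) → MonoidAlgebra k (FreeMonoid ι) := fun z =>
    if 0 < z.1 then strLift (letter b) i z.1 (c z.1 z.2) else 0
  let S : Finset (Σ a, J a) := (Finset.Icc 1 n).sigma fun _ => Finset.univ
  have hcoef : ∀ z ∈ S, coef z = 0 := by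
    refine eq_zero_of_sum_mul_eq_zero (wordAct b ρ) (wordAct_mem_wordDeg b ρ) Sigma.fst β ?_ ?_
      (n + 1) n S coef ?_ ?_ ?_ ?_
    · intro z
      by_cases hz : 0 < z.1
      · simp only [β, hz, if_true]
        rw [← compositeDeg_sup_map_irr b hIrr i hz]
        exact Submodule.mem_sup_right ⟨_, (c z.1 z.2).2, rfl⟩
      · simp only [β, hz, if_false]
        exact zero_mem _
    · intro m t a hm ht hmem
      refine eq_zero_of_sum_mem_compositeDeg b hIrr i hm c t ht a ?_
      convert hmem using 1
      exact Finset.sum_congr rfl fun z hz => by simp only [β, ht z hz, hm, if_true]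
    · rintro ⟨a, j⟩ hz
      simp only [S, Finset.mem_sigma, Finset.mem_Icc] at hz
      exact hz.1.1
    · rintro ⟨a, j⟩ hz
      simp only [S, Finset.mem_sigma, Finset.mem_Icc] at hz
      exact Nat.lt_succ_of_le hz.1.2
    · rintro ⟨a, j⟩ hz
      simp only [S, Finset.mem_sigma, Finset.mem_Icc] at hz
      refine ⟨n - a, Nat.sub_add_cancel hz.1.2, sum_mem fun l hl => ?_⟩
      have h1 := (hs _ ((htails a l).1 hl)).1
      rw [List.sum_cons] at h1
      have h2 : l.sum = n - a := by omega
      exact h2 ▸ partLift_mem Irr b _ l _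
    · rw [← h0, ← sum_sum_cons s fun l hl => ⟨(hs l hl).1 ▸ hn, (hs l hl).1.le, (hs l hl).2⟩,
        Finset.sum_sigma]
      refine Finset.sum_congr rfl fun a ha => ?_
      have ha' : 0 < a := (Finset.mem_Icc.1 ha).1
      simp only [coef, β, ha', if_true, Finset.sum_mul]
      rw [Finset.sum_comm]
      refine Finset.sum_congr rfl fun l _ => ?_
      conv_rhs => rw [← sum_tIrrCoord Irr (c a) l (x (a :: l)), map_sum]
      exact Finset.sum_congr rfl fun j _ => (partLift_tIrrCons Irr b i a l _ _).symm
  intro l hl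
  rcases l with _ | ⟨a, l⟩
  · have := (hs _ hl).1
    simp at this
    omega
  · have h1 := (hs _ hl).1
    have h2 := (hs _ hl).2
    have ha := h2 a List.mem_cons_self
    rw [List.sum_cons] at h1
    apply (tIrrCoord Irr (c a) l).injective
    rw [map_zero]
    ext j
    refine ih (n - a) (by omega) (i + a) (tails a) (fun l' hl' => ?_)
      (fun l' => tIrrCoord Irr (c a) l' (x (a :: l')) j)
      (hcoef ⟨a, j⟩ (by simp only [S, Finset.mem_sigma, Finset.mem_Icc, Finset.mem_univ, and_true]; omega))
      l ((htails a l).2 hl)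
    have h3 := hs _ ((htails a l').1 hl')
    rw [List.sum_cons] at h3
    exact ⟨by omega, fun d hd => h3.2 d (List.mem_cons_of_mem _ hd)⟩

lemma toModule_partLift_injective [FiniteDimensional k M₀] (hIrr : IsIrreducibleChoice Irr ρ)
    (i n : ℕ) :
    Function.Injective (DirectSum.toModule k (Pt n) _ fun p => partLift Irr b i p.1) := by
  refine toModule_injective _ fun s x h0 p hp => ?_
  let y : ∀ l, ↥(TIrr (k := k) (fun _ => M₀) Irr i l) := fun l =>
    if h : l.sum = n ∧ ∀ a ∈ l, 0 < a then x (⟨l, h⟩ : Pt n) else 0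
  have hy : ∀ p : Pt n, y p.1 = x p := fun p => dif_pos p.2
  have hsum : ∑ l ∈ s.image (fun p : Pt n => p.1), partLift Irr b i l (y l) = 0 := by
    refine (Finset.sum_image fun p _ q _ h => Subtype.ext h).trans (Eq.trans ?_ h0)
    exact Finset.sum_congr rfl fun p _ => congr_arg _ (hy p)
  have h := eq_zero_of_sum_partLift_eq_zero b hIrr n i _ (fun l hl => by
    obtain ⟨p, _, rfl⟩ := Finset.mem_image.1 hl
    exact p.2) y hsum
  exact (hy p).symm.trans (h _ (Finset.mem_image_of_mem _ hp))

lemma iSup_range_partLift (hIrr : IsIrreducibleChoice Irr ρ) (i n : ℕ) :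
    ⨆ p : Pt n, LinearMap.range (partLift Irr b i p.1) = fixedDeg (wordAct b ρ) n := by
  refine le_antisymm (iSup_le fun p => ?_) (fixedDeg_le_iSup b hIrr i n)
  exact (range_partLift_le b hIrr i p.1 p.2.2).trans (le_of_eq (by rw [p.2.1]))

lemma strLift_comp_psiMap (n : ℕ) :
    strLift (letter b) 0 n ∘ₗ psiMap (k := k) (fun _ => M₀) Irr n =
      DirectSum.toModule k (Pt n) _ fun p => partLift Irr b 0 p.1 := by
  refine DirectSum.linearMap_ext k fun p => LinearMap.ext fun x => ?_
  simp only [psiMap, LinearMap.comp_apply, DirectSum.toModule_lof]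
  exact strLift_strCastLen (letter b) p.2.1 _

end Partitions

/-- Bijectivity of `ψ` for a constant sequence of modules. -/
theorem psi_bijective_constant
    {k G : Type} [Field k] [Group G] [Finite G]
    (M₀ : Type) [AddCommGroup M₀] [Module k M₀] [FiniteDimensional k M₀]
    (ρ₀ : Representation k G M₀)
    (Irr : ∀ i m : ℕ, Submodule k ↥(Str (k := k) (fun _ => M₀) i m))
    (hIrr : ∀ i m : ℕ, 0 < m →
      strComp (fun _ => M₀) (fun _ => ρ₀) i m ⊓ Irr i m = ⊥ ∧
      strComp (fun _ => M₀) (fun _ => ρ₀) i m ⊔ Irr i m =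
        strInv (fun _ => M₀) (fun _ => ρ₀) i m)
    (n : ℕ) :
    Function.Injective (psiMap (k := k) (fun _ => M₀) Irr n) ∧
    LinearMap.range (psiMap (k := k) (fun _ => M₀) Irr n) =
      strInv (fun _ => M₀) (fun _ => ρ₀) 0 n := by
  let b := Module.Basis.ofVectorSpace k M₀
  constructor
  · apply Function.Injective.of_comp (f := strLift (letter b) 0 n)
    rw [← LinearMap.coe_comp, strLift_comp_psiMap]
    exact toModule_partLift_injective (ρ := ρ₀) b hIrr 0 n
  · apply Submodule.map_injective_of_injective (strLift_injective b 0 n)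
    rw [← LinearMap.range_comp, strLift_comp_psiMap, map_strInv, range_toModule]
    exact iSup_range_partLift (ρ := ρ₀) b hIrr 0 n
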